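/- arXiv:2407.21680 — 7 statements merged into one kernel-verified Lean document; each statement's English description precedes it below -/
import Mathlib

section
/- For all natural numbers j and k, the identity j·C(j+k−1, k) − j·C(j+k, k) + (j+1)·C(j+k+1, k) = k·C(j+k−1, j) − k·C(j+k, j) + (k+1)·C(j+k+1, j) holds in ℝ, where C(a,b) denotes the binomial coefficient (a choose b). (This is the entrywise statement that the semi-infinite symmetric Pascal matrix T with entries T_{jk} = C(j+k, j) commutes with the semi-infinite Jacobi matrix J having diagonal entries b_n = −n and off-diagonal entries a_n = n in positions (n−1,n) and (n,n−1).) -/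
/-- Raising the first index of the symmetric Pascal matrix. -/
theorem succ_mul_choose_add_succ (j k : ℕ) :
    (j + 1) * (j + k + 1).choose k = (j + k + 1) * (j + k).choose k := by
  have h := Nat.add_one_mul_choose_eq (j + k) j
  have h1 : (j + k + 1).choose (j + 1) = (j + k + 1).choose k :=
    Nat.choose_symm_of_eq_add (by omega)
  rw [h1, Nat.choose_symm_add] at h
  rw [h, mul_comm]

/-- The semi-infinite symmetric Pascal matrix `T_{jk} = C(j+k, j)` commutes with the
semi-infinite Jacobi matrix `J` with diagonal `b_n = -n` and off-diagonal `a_n = n`,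
stated entrywise. -/
theorem pascal_commutes_jacobi_entrywise (j k : ℕ) :
    (j : ℝ) * (Nat.choose (j + k - 1) k : ℝ)
      - (j : ℝ) * (Nat.choose (j + k) k : ℝ)
      + ((j : ℝ) + 1) * (Nat.choose (j + k + 1) k : ℝ)
  = (k : ℝ) * (Nat.choose (j + k - 1) j : ℝ)
      - (k : ℝ) * (Nat.choose (j + k) j : ℝ)
      + ((k : ℝ) + 1) * (Nat.choose (j + k + 1) j : ℝ) := by
  rcases j with _ | a
  · simp
  rcases k with _ | b
  · simp
  have e : a + 1 + (b + 1) - 1 = a + b + 1 := by omega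
  have hj := succ_mul_choose_add_succ (a + 1) (b + 1)
  have hk := succ_mul_choose_add_succ (b + 1) (a + 1)
  rw [add_comm (b + 1) (a + 1)] at hk
  have symm : (a + 1 + (b + 1)).choose (b + 1) = (a + 1 + (b + 1)).choose (a + 1) :=
    Nat.choose_symm_add.symm
  have pascal : (a + 1 + (b + 1)).choose (a + 1) =
      (a + b + 1).choose (b + 1) + (a + b + 1).choose (a + 1) := by
    have h := Nat.choose_succ_succ' (a + b + 1) a
    rwa [Nat.choose_symm_of_eq_add (show a + b + 1 = a + (b + 1) by omega),
      show a + b + 1 + 1 = a + 1 + (b + 1) by omega] at h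
  have swap := succ_mul_choose_add_succ a (b + 1)
  rw [show a + (b + 1) + 1 = a + 1 + (b + 1) by omega,
    show a + (b + 1) = a + b + 1 by omega] at swap
  rw [symm] at hj swap ⊢
  rw [pascal] at hj hk swap ⊢
  rw [e]
  rify at hj hk swap
  push_cast at hj hk swap ⊢
  linear_combination hj - hk - swap
end

section
/- For every natural number N, the N×N Pascal matrix T_N commutes with the N×N Jacobi matrix J_N: J_N * T_N = T_N * J_N. -/
open Matrix

/-- The `N × N` symmetric Pascal matrix, `(T_N)_{jk} = C(j+k, j)`. -/
noncomputable def pascalT (N : ℕ) : Matrix (Fin N) (Fin N) ℝ :=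
  fun j k => (Nat.choose (j.1 + k.1) j.1 : ℝ)

/-- The `N × N` lower-triangular Pascal matrix, `(Ψ_N)_{jk} = C(j, k)`. -/
noncomputable def psiMat (N : ℕ) : Matrix (Fin N) (Fin N) ℝ :=
  fun j k => (Nat.choose j.1 k.1 : ℝ)

/-- The `N × N` diagonal sign matrix `Λ_N = diag(1, -1, 1, …)`. -/
noncomputable def lamMat (N : ℕ) : Matrix (Fin N) (Fin N) ℝ :=
  Matrix.diagonal fun j => (-1 : ℝ) ^ j.1

/-- The `N × N` symmetric tridiagonal (Jacobi) matrix `J_N` with diagonal entries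
`(J_N)_{jj} = -N²·j + 2j³ + 3j² + 2j` and off-diagonal entries
`(J_N)_{j,j+1} = (J_N)_{j+1,j} = (j+1)·(N² - (j+1)²)`. -/
noncomputable def jacobiJ (N : ℕ) : Matrix (Fin N) (Fin N) ℝ :=
  fun j k =>
    if j.1 = k.1 then
      -((N : ℝ) ^ 2) * (j.1 : ℝ) + 2 * (j.1 : ℝ) ^ 3 + 3 * (j.1 : ℝ) ^ 2 + 2 * (j.1 : ℝ)
    else if j.1 + 1 = k.1 then (k.1 : ℝ) * ((N : ℝ) ^ 2 - (k.1 : ℝ) ^ 2)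
    else if k.1 + 1 = j.1 then (j.1 : ℝ) * ((N : ℝ) ^ 2 - (j.1 : ℝ) ^ 2)
    else 0

/-- A row of the Jacobi matrix acts as a three-term operator; no boundary term is needed at
`j = N - 1` because the weight `(j + 1) * (N ^ 2 - (j + 1) ^ 2)` vanishes there. -/
theorem sum_jacobiJ_mul (N : ℕ) (j : Fin N) (g : ℕ → ℝ) :
    ∑ l : Fin N, jacobiJ N j l * g l =
      (j : ℝ) * ((N : ℝ) ^ 2 - (j : ℝ) ^ 2) * g (j - 1)
        + (-((N : ℝ) ^ 2) * (j : ℝ) + 2 * (j : ℝ) ^ 3 + 3 * (j : ℝ) ^ 2 + 2 * (j : ℝ)) * g j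
        + ((j : ℝ) + 1) * ((N : ℝ) ^ 2 - ((j : ℝ) + 1) ^ 2) * g (j + 1) := by
  obtain ⟨j, hj⟩ := j
  obtain ⟨f, hf⟩ : ∃ f : ℕ → ℝ, f = fun l =>
      (if j - 1 = l then (j : ℝ) * ((N : ℝ) ^ 2 - (j : ℝ) ^ 2) * g l else 0)
      + (if j = l then
          (-((N : ℝ) ^ 2) * (j : ℝ) + 2 * (j : ℝ) ^ 3 + 3 * (j : ℝ) ^ 2 + 2 * (j : ℝ)) * g l
        else 0)
      + (if j + 1 = l then ((j : ℝ) + 1) * ((N : ℝ) ^ 2 - ((j : ℝ) + 1) ^ 2) * g l else 0) :=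
    ⟨_, rfl⟩
  have hsplit : ∀ l : Fin N, jacobiJ N ⟨j, hj⟩ l * g l = f l := by
    rintro ⟨l, hl⟩
    simp only [jacobiJ, hf]
    rcases Nat.eq_zero_or_pos j with rfl | hpos <;> split_ifs <;>
      first | omega | (subst_vars; push_cast; ring)
  rw [Finset.sum_congr rfl fun l _ => hsplit l, Fin.sum_univ_eq_sum_range f, hf,
    Finset.sum_add_distrib, Finset.sum_add_distrib, Finset.sum_ite_eq, Finset.sum_ite_eq,
    Finset.sum_ite_eq, if_pos (Finset.mem_range.2 (by omega)), if_pos (Finset.mem_range.2 hj)]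
  split_ifs with h
  · rfl
  · have hN : (N : ℝ) = j + 1 := by
      rw [Finset.mem_range] at h
      exact_mod_cast (by omega : N = j + 1)
    rw [hN]
    ring

/-- The three-term operator of the Jacobi matrix, applied to the Pascal numbers in the first
index, in closed form. -/
theorem jacobi_three_term_choose (c : ℝ) (j k : ℕ) (h : 0 < j + k) :
    (j : ℝ) * (c - (j : ℝ) ^ 2) * ((j - 1 + k).choose (j - 1) : ℝ)
        + (-c * (j : ℝ) + 2 * (j : ℝ) ^ 3 + 3 * (j : ℝ) ^ 2 + 2 * (j : ℝ))
          * ((j + k).choose j : ℝ)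
        + ((j : ℝ) + 1) * (c - ((j : ℝ) + 1) ^ 2) * ((j + 1 + k).choose (j + 1) : ℝ) =
      ((j : ℝ) ^ 2 * (c - (j : ℝ) ^ 2)
        + (-c * (j : ℝ) + 2 * (j : ℝ) ^ 3 + 3 * (j : ℝ) ^ 2 + 2 * (j : ℝ)) * (j + k)
        + (c - ((j : ℝ) + 1) ^ 2) * (j + k + 1) * (j + k))
        * (((j + k).choose j : ℝ) / (j + k)) := by
  have hne : (j : ℝ) + k ≠ 0 := by exact_mod_cast h.ne'
  have hsucc : ((j : ℝ) + 1) * ((j + 1 + k).choose (j + 1) : ℝ)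
      = (j + k + 1) * ((j + k).choose j : ℝ) := by
    have := Nat.add_one_mul_choose_eq (j + k) j
    rw [show j + 1 + k = j + k + 1 by ring]
    have h' : ((j : ℝ) + k + 1) * ((j + k).choose j : ℝ)
      = ((j + k + 1).choose (j + 1) : ℝ) * (j + 1) := by exact_mod_cast this
    rw [h']
    ring
  have hpred : (j : ℝ) * (((j - 1 + k).choose (j - 1) : ℝ) * (j + k))
      = j * (j * ((j + k).choose j : ℝ)) := by
    cases j with
    | zero => simp
    | succ i =>
      have := Nat.add_one_mul_choose_eq (i + k) i
      rw [show i + 1 + k = i + k + 1 by ring, Nat.add_sub_cancel]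
      have h' : ((i : ℝ) + k + 1) * ((i + k).choose i : ℝ)
        = ((i + k + 1).choose (i + 1) : ℝ) * (i + 1) := by exact_mod_cast this
      push_cast
      linear_combination ((i : ℝ) + 1) * h'
  field_simp
  linear_combination (c - (j : ℝ) ^ 2) * hpred + (c - ((j : ℝ) + 1) ^ 2) * (j + k) * hsucc

theorem jacobiJ_isSymm (N : ℕ) : (jacobiJ N).IsSymm := by
  ext j k
  simp only [transpose_apply, jacobiJ]
  split_ifs with h₁ h₂ <;> first | omega | rfl | simp [h₁]

theorem pascalT_isSymm (N : ℕ) : (pascalT N).IsSymm := by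
  ext j k
  simp only [transpose_apply, pascalT]
  rw [Nat.choose_symm_add, add_comm]

theorem jacobiJ_mul_pascalT_isSymm (N : ℕ) : (jacobiJ N * pascalT N).IsSymm := by
  ext j k
  simp only [transpose_apply, mul_apply, pascalT]
  rw [sum_jacobiJ_mul N k fun l => ((l + j).choose l : ℝ),
    sum_jacobiJ_mul N j fun l => ((l + k).choose l : ℝ)]
  rcases Nat.eq_zero_or_pos ((j : ℕ) + k) with h | h
  · obtain ⟨hj, hk⟩ := Nat.add_eq_zero_iff.1 h
    rw [hj, hk]
  · rw [jacobi_three_term_choose _ _ _ h, jacobi_three_term_choose _ _ _ (by omega),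
      Nat.choose_symm_add, add_comm (k : ℕ), add_comm (k : ℝ)]
    ring

/-- The `N × N` Pascal matrix `T_N` commutes with the Jacobi matrix `J_N`. -/
theorem jacobi_commutes_pascal (N : ℕ) :
    jacobiJ N * pascalT N = pascalT N * jacobiJ N := by
  rw [← (jacobiJ_mul_pascalT_isSymm N).eq, transpose_mul, (jacobiJ_isSymm N).eq,
    (pascalT_isSymm N).eq]
end

section
/- Let N be a natural number, λ : ℝ, and v : Fin N → ℝ with J_N.mulVec v = λ • v. Then the binomial transform w := (Ψ_N * Λ_N).mulVec v satisfies J_N.mulVec w = (N² − 1 − λ) • w; moreover if v ≠ 0 then w ≠ 0. In particular the spectrum of J_N is invariant under the reflection λ ↦ N² − 1 − λ. -/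
open Matrix

/-- The action of `J_N` as a three-term recurrence; no boundary terms are needed because the
off-diagonal coefficient `k (N² - k²)` vanishes at `k = 0` and `k = N`. -/
theorem jacobiJ_mulVec_apply (N : ℕ) (f : ℕ → ℝ) (i : Fin N) :
    (jacobiJ N).mulVec (fun j => f j.1) i =
      (i.1 : ℝ) * ((N : ℝ) ^ 2 - (i.1 : ℝ) ^ 2) * f (i.1 - 1) +
      (-((N : ℝ) ^ 2) * (i.1 : ℝ) + 2 * (i.1 : ℝ) ^ 3 + 3 * (i.1 : ℝ) ^ 2 + 2 * (i.1 : ℝ)) * f i.1 +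
      ((i.1 : ℝ) + 1) * ((N : ℝ) ^ 2 - ((i.1 : ℝ) + 1) ^ 2) * f (i.1 + 1) := by
  obtain ⟨i, hi⟩ := i
  set a : ℝ := -((N : ℝ) ^ 2) * (i : ℝ) + 2 * (i : ℝ) ^ 3 + 3 * (i : ℝ) ^ 2 + 2 * (i : ℝ) with ha
  have split_entry : ∀ j : ℕ,
      (if i = j then a
        else if i + 1 = j then (j : ℝ) * ((N : ℝ) ^ 2 - (j : ℝ) ^ 2)
        else if j + 1 = i then (i : ℝ) * ((N : ℝ) ^ 2 - (i : ℝ) ^ 2) else 0) * f j =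
      (if i - 1 = j then (i : ℝ) * ((N : ℝ) ^ 2 - (i : ℝ) ^ 2) * f j else 0) +
      (if i = j then a * f j else 0) +
      (if i + 1 = j then (j : ℝ) * ((N : ℝ) ^ 2 - (j : ℝ) ^ 2) * f j else 0) := by
    intro j
    rcases Nat.eq_zero_or_pos i with rfl | h0
    · simp only [Nat.cast_zero]
      split_ifs <;> first | omega | simp
    · split_ifs <;> first | omega | simp
  have hsum : (jacobiJ N).mulVec (fun j => f j.1) ⟨i, hi⟩ = ∑ j ∈ Finset.range N,
      ((if i - 1 = j then (i : ℝ) * ((N : ℝ) ^ 2 - (i : ℝ) ^ 2) * f j else 0) +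
      (if i = j then a * f j else 0) +
      (if i + 1 = j then (j : ℝ) * ((N : ℝ) ^ 2 - (j : ℝ) ^ 2) * f j else 0)) := by
    rw [← Fin.sum_univ_eq_sum_range (fun j => (if i - 1 = j then _ else (0 : ℝ)) +
      (if i = j then a * f j else 0) + (if i + 1 = j then _ else 0))]
    rw [Matrix.mulVec, dotProduct]
    exact Finset.sum_congr rfl fun j _ => split_entry j.1
  rw [hsum, Finset.sum_add_distrib, Finset.sum_add_distrib, Finset.sum_ite_eq, Finset.sum_ite_eq,
    Finset.sum_ite_eq, if_pos (Finset.mem_range.2 (by omega)), if_pos (Finset.mem_range.2 hi)]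
  congr 1
  split_ifs with h
  · push_cast; ring
  · have hN : N = i + 1 := by have := Finset.mem_range.not.1 h; omega
    subst hN
    push_cast; ring

theorem jacobiJ_transpose (N : ℕ) : (jacobiJ N)ᵀ = jacobiJ N := by
  ext j k
  simp only [Matrix.transpose_apply, jacobiJ]
  split_ifs with h₁ <;> first | omega | simp [h₁]

theorem psiMat_mul_lamMat_apply (N : ℕ) (j k : Fin N) :
    (psiMat N * lamMat N) j k = (Nat.choose j.1 k.1 : ℝ) * (-1) ^ k.1 := by
  rw [lamMat, Matrix.mul_diagonal, psiMat]

theorem cast_mul_choose_pred (j k : ℕ) :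
    (j : ℝ) * (Nat.choose (j - 1) k : ℝ) = ((j : ℝ) - k) * Nat.choose j k := by
  rcases j with _ | j
  · rcases k with _ | k <;> simp
  · rcases le_or_gt k (j + 1) with h | h
    · have := Nat.choose_mul_succ_eq j k
      have h' : ((j.choose k * (j + 1) : ℕ) : ℝ) = ((j + 1).choose k * (j + 1 - k) : ℕ) := by
        rw [this]
      rw [Nat.cast_mul, Nat.cast_mul, Nat.cast_sub h] at h'
      rw [Nat.add_sub_cancel]
      push_cast at h' ⊢
      linarith
    · rw [Nat.choose_eq_zero_of_lt h, Nat.choose_eq_zero_of_lt (by omega)]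
      simp

theorem cast_succ_mul_choose_succ (j k : ℕ) :
    ((k : ℝ) + 1) * (Nat.choose j (k + 1) : ℝ) = ((j : ℝ) - k) * Nat.choose j k := by
  rcases le_or_gt k j with h | h
  · have h' : ((j.choose (k + 1) * (k + 1) : ℕ) : ℝ) = (j.choose k * (j - k) : ℕ) := by
      rw [Nat.choose_succ_right_eq]
    push_cast [Nat.cast_sub h] at h'
    linarith
  · rw [Nat.choose_eq_zero_of_lt h, Nat.choose_eq_zero_of_lt (by omega)]
    simp

theorem jacobiJ_mul_add_mul_jacobiJ (N : ℕ) :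
    jacobiJ N * (psiMat N * lamMat N) + psiMat N * lamMat N * jacobiJ N =
      ((N : ℝ) ^ 2 - 1) • (psiMat N * lamMat N) := by
  ext j k
  have hleft : (jacobiJ N * (psiMat N * lamMat N)) j k =
      (jacobiJ N).mulVec (fun i => (Nat.choose i.1 k.1 : ℝ) * (-1) ^ k.1) j := by
    rw [Matrix.mul_apply]
    exact Finset.sum_congr rfl fun i _ => by rw [psiMat_mul_lamMat_apply]
  have hright : (psiMat N * lamMat N * jacobiJ N) j k =
      (jacobiJ N).mulVec (fun i => (Nat.choose j.1 i.1 : ℝ) * (-1) ^ i.1) k := by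
    rw [Matrix.mul_apply]
    refine Finset.sum_congr rfl fun i _ => ?_
    rw [psiMat_mul_lamMat_apply, mul_comm]
    exact congrArg (· * _) (congrFun (congrFun (jacobiJ_transpose N) k) i)
  rw [Matrix.add_apply, Matrix.smul_apply, hleft, hright,
    jacobiJ_mulVec_apply N (fun m => (Nat.choose m k.1 : ℝ) * (-1) ^ k.1),
    jacobiJ_mulVec_apply N (fun m => (Nat.choose j.1 m : ℝ) * (-1) ^ m), psiMat_mul_lamMat_apply, smul_eq_mul]
  obtain ⟨j, -⟩ := j
  obtain ⟨k, -⟩ := k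
  have hpred := cast_mul_choose_pred j k
  have hsucc := cast_succ_mul_choose_succ j k
  dsimp only
  rcases k with _ | k
  · simp only [Nat.choose_zero_right, Nat.cast_zero, zero_add] at *
    push_cast at *
    linear_combination - ((N : ℝ) ^ 2 - 1) * hsucc
  · have hprev := cast_succ_mul_choose_succ j k
    rw [Nat.choose_succ_succ j k, Nat.add_sub_cancel, pow_succ (-1 : ℝ) (k + 1),
      pow_succ (-1 : ℝ) k]
    push_cast at *
    linear_combination (-1) ^ k * (-((N : ℝ) ^ 2 - (j : ℝ) ^ 2) * hpred +
      ((N : ℝ) ^ 2 - ((k : ℝ) + 2) ^ 2) * hsucc +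
      ((N : ℝ) ^ 2 - ((j : ℝ) + 1) ^ 2 - ((j : ℝ) + 1) * (k + 1) - ((k : ℝ) + 1) ^ 2) * hprev)

theorem det_psiMat_mul_lamMat_ne_zero (N : ℕ) : (psiMat N * lamMat N).det ≠ 0 := by
  rw [Matrix.det_of_isLowerTriangular]
  · simp [psiMat_mul_lamMat_apply, Finset.prod_ne_zero_iff]
  · intro i j hij
    have hlt : i.1 < j.1 := hij
    rw [psiMat_mul_lamMat_apply, Nat.choose_eq_zero_of_lt hlt]
    simp

/-- If `v` is an eigenvector of `J_N` with eigenvalue `λ`, then its binomial transform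
`w = (Ψ_N Λ_N) v` satisfies `J_N w = (N² - 1 - λ) w`; moreover `w ≠ 0` whenever `v ≠ 0`.
In particular the spectrum of `J_N` is invariant under `λ ↦ N² - 1 - λ`. -/
theorem jacobi_spectrum_reflection (N : ℕ) (lam : ℝ) (v : Fin N → ℝ)
    (h : (jacobiJ N).mulVec v = lam • v) :
    (jacobiJ N).mulVec ((psiMat N * lamMat N).mulVec v)
        = ((N : ℝ) ^ 2 - 1 - lam) • (psiMat N * lamMat N).mulVec v ∧
      (v ≠ 0 → (psiMat N * lamMat N).mulVec v ≠ 0) := by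
  refine ⟨?_, fun hv hw => hv (Matrix.eq_zero_of_mulVec_eq_zero
    (det_psiMat_mul_lamMat_ne_zero N) hw)⟩
  have key := congrArg (fun M => M.mulVec v) (jacobiJ_mul_add_mul_jacobiJ N)
  simp only [Matrix.add_mulVec, Matrix.smul_mulVec] at key
  rw [← Matrix.mulVec_mulVec v (jacobiJ N), ← Matrix.mulVec_mulVec v _ (jacobiJ N), h,
    Matrix.mulVec_smul] at key
  rw [sub_smul _ lam, ← key, add_sub_cancel_right]
end

section
/- Let N be a natural number, λ : ℝ, and v : Fin N → ℝ nonzero with T_N.mulVec v = λ • v. Then λ ≠ 0, the binomial transform w := (Ψ_N * Λ_N).mulVec v is nonzero, and T_N.mulVec w = λ⁻¹ • w. -/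
open Matrix

/-- Orthogonality of the binomial coefficients and their signed counterparts. -/
lemma sum_range_choose_mul_neg_one_pow_mul_choose (i k : ℕ) :
    ∑ j ∈ Finset.range (i + 1), (i.choose j : ℝ) * (-1) ^ j * (j.choose k : ℝ)
      = if i = k then (-1) ^ i else 0 := by
  rcases lt_or_ge i k with hik | hki
  · rw [if_neg hik.ne]
    refine Finset.sum_eq_zero fun j hj => ?_
    rw [Nat.choose_eq_zero_of_lt (n := j) (k := k) (by grind)]
    simp
  · obtain ⟨d, rfl⟩ := Nat.exists_eq_add_of_le hki
    have halt : ∑ m ∈ Finset.range (d + 1), (-1 : ℝ) ^ m * (d.choose m : ℝ)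
        = if d = 0 then 1 else 0 := by
      exact_mod_cast congrArg (Int.cast : ℤ → ℝ) (Int.alternating_sum_range_choose (n := d))
    have hlow : ∑ j ∈ Finset.range k,
        ((k + d).choose j : ℝ) * (-1) ^ j * (j.choose k : ℝ) = 0 := by
      refine Finset.sum_eq_zero fun j hj => ?_
      rw [Nat.choose_eq_zero_of_lt (Finset.mem_range.1 hj)]
      simp
    have hterm (m : ℕ) :
        ((k + d).choose (k + m) : ℝ) * (-1) ^ (k + m) * ((k + m).choose k : ℝ)
          = (-1) ^ k * ((k + d).choose k : ℝ) * ((-1) ^ m * (d.choose m : ℝ)) := by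
      have hmul := Nat.choose_mul (n := k + d) (Nat.le_add_right k m)
      simp only [Nat.add_sub_cancel_left] at hmul
      have hmul' : ((k + d).choose (k + m) : ℝ) * ((k + m).choose k : ℝ)
          = ((k + d).choose k : ℝ) * (d.choose m : ℝ) := by exact_mod_cast hmul
      rw [pow_add]
      linear_combination (-1) ^ k * (-1) ^ m * hmul'
    rw [add_assoc, Finset.sum_range_add, hlow, zero_add, Finset.sum_congr rfl fun m _ => hterm m,
      ← Finset.mul_sum, halt]
    by_cases hd : d = 0 <;> simp [hd]

/-- A sum over `Fin N` whose terms vanish above `i < N` is a sum over `range (i + 1)`. -/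
lemma sum_fin_eq_sum_range_succ {M : Type*} [AddCommMonoid M] {N i : ℕ} (hi : i < N) (f : ℕ → M)
    (hf : ∀ j, i < j → f j = 0) :
    ∑ j : Fin N, f j = ∑ j ∈ Finset.range (i + 1), f j := by
  rw [Fin.sum_univ_eq_sum_range]
  refine (Finset.sum_subset (Finset.range_mono hi) fun j _ hj => hf j ?_).symm
  simpa [Nat.lt_succ_iff] using hj

lemma psiMat_mul_lamMat_mul_psiMat (N : ℕ) : psiMat N * lamMat N * psiMat N = lamMat N := by
  ext i k
  rw [Matrix.mul_apply]
  simp only [lamMat, Matrix.mul_diagonal, psiMat]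
  rw [sum_fin_eq_sum_range_succ i.2
      (fun j => (i.1.choose j : ℝ) * (-1) ^ j * (j.choose k.1 : ℝ))
      (fun j hj => by simp [Nat.choose_eq_zero_of_lt hj]),
    sum_range_choose_mul_neg_one_pow_mul_choose, Matrix.diagonal_apply]
  simp only [Fin.ext_iff]

lemma pascalT_eq_psiMat_mul_transpose (N : ℕ) : pascalT N = psiMat N * (psiMat N)ᵀ := by
  ext j k
  simp only [Matrix.mul_apply, Matrix.transpose_apply, psiMat, pascalT]
  rw [sum_fin_eq_sum_range_succ j.2
      (fun m => (j.1.choose m : ℝ) * (k.1.choose m : ℝ))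
      (fun m hm => by simp [Nat.choose_eq_zero_of_lt hm]),
    add_comm j.1, Nat.add_choose_eq, Finset.Nat.sum_antidiagonal_eq_sum_range_succ_mk]
  push_cast
  refine Finset.sum_congr rfl fun m hm => ?_
  rw [Nat.choose_symm (Nat.lt_succ_iff.1 (Finset.mem_range.1 hm)), mul_comm]

lemma lamMat_mul_self (N : ℕ) : lamMat N * lamMat N = 1 := by
  simp [lamMat, Matrix.diagonal_mul_diagonal, ← mul_pow]

/-- The signed binomial transform is an involution. -/
lemma psiMat_mul_lamMat_mul_self (N : ℕ) :
    psiMat N * lamMat N * (psiMat N * lamMat N) = 1 := by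
  rw [← Matrix.mul_assoc, psiMat_mul_lamMat_mul_psiMat, lamMat_mul_self]

/-- The signed binomial transform conjugates the symmetric Pascal matrix to its inverse. -/
lemma pascalT_mul_psiMat_mul_lamMat_mul_pascalT (N : ℕ) :
    pascalT N * (psiMat N * lamMat N) * pascalT N = psiMat N * lamMat N := by
  have htr : (psiMat N)ᵀ * lamMat N * (psiMat N)ᵀ = lamMat N := by
    have := congrArg Matrix.transpose (psiMat_mul_lamMat_mul_psiMat N)
    simpa [Matrix.transpose_mul, lamMat, Matrix.mul_assoc] using this
  calc pascalT N * (psiMat N * lamMat N) * pascalT N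
      = psiMat N * ((psiMat N)ᵀ * (psiMat N * lamMat N * psiMat N) * (psiMat N)ᵀ) := by
        simp only [pascalT_eq_psiMat_mul_transpose, Matrix.mul_assoc]
    _ = psiMat N * lamMat N := by rw [psiMat_mul_lamMat_mul_psiMat, htr]

/-- If `v` is a nonzero eigenvector of `T_N` with eigenvalue `λ`, then `λ ≠ 0` and the
binomial transform `w = (Ψ_N Λ_N) v` is a nonzero eigenvector of `T_N` with eigenvalue `λ⁻¹`. -/
theorem pascal_eigenvalue_inverse (N : ℕ) (lam : ℝ) (v : Fin N → ℝ) (hv : v ≠ 0)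
    (h : (pascalT N).mulVec v = lam • v) :
    lam ≠ 0 ∧ (psiMat N * lamMat N).mulVec v ≠ 0 ∧
      (pascalT N).mulVec ((psiMat N * lamMat N).mulVec v)
        = lam⁻¹ • (psiMat N * lamMat N).mulVec v := by
  have hw : (psiMat N * lamMat N).mulVec v ≠ 0 := fun h0 => hv <| by
    rw [← Matrix.one_mulVec v, ← psiMat_mul_lamMat_mul_self, ← Matrix.mulVec_mulVec, h0,
      Matrix.mulVec_zero]
  have key : lam • (pascalT N).mulVec ((psiMat N * lamMat N).mulVec v)
      = (psiMat N * lamMat N).mulVec v := by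
    rw [← Matrix.mulVec_smul, ← Matrix.mulVec_smul, ← h, Matrix.mulVec_mulVec,
      Matrix.mulVec_mulVec, pascalT_mul_psiMat_mul_lamMat_mul_pascalT]
  have hlam : lam ≠ 0 := by
    rintro rfl
    exact hw (by rw [← key, zero_smul])
  exact ⟨hlam, hw, (eq_inv_smul_iff₀ hlam).2 key⟩
end

section
/- For all natural numbers n, ℓ, y with ℓ ≤ n, the following identity holds in ℝ: Σ_{x=0}^{y+ℓ} (−1)^x · x^n · C(y+ℓ, x) · C(x, y) = (−1)^{y+ℓ} · Σ_{0 ≤ i₁ ≤ i₂ ≤ ⋯ ≤ i_ℓ ≤ n−ℓ} y^{i₁} · (y+1)^{i₂−i₁+1} · (y+2)^{i₃−i₂+1} ⋯ (y+ℓ−1)^{i_ℓ−i_{ℓ−1}+1} · (y+ℓ)^{n−ℓ−i_ℓ+1}, where the right-hand sum is over all weakly increasing ℓ-tuples (i₁,…,i_ℓ) of natural numbers bounded by n−ℓ; for ℓ = 0 the right-hand side is (−1)^y · y^n. -/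
/-- Given a weakly increasing tuple `i : Fin ℓ → Fin (n - ℓ + 1)` (so `0 ≤ i₁ ≤ ⋯ ≤ i_ℓ ≤ n - ℓ`
in 1-based notation), the extended index sequence with `i'_0 = 1`, `i'_j = i_j` for
`1 ≤ j ≤ ℓ`, and `i'_j = n - ℓ` for `j > ℓ`. -/
def extIdx (n ℓ : ℕ) (i : Fin ℓ → Fin (n - ℓ + 1)) : ℕ → ℕ :=
  fun j => if j = 0 then 1 else if h : j - 1 < ℓ then (i ⟨j - 1, h⟩ : ℕ) else n - ℓ

open Finset

/-- The sum `Σ_x (-1)^x x^n C(y+ℓ, x) C(x, y)`. -/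
noncomputable def altBinomialSum (n ℓ y : ℕ) : ℝ :=
  ∑ x ∈ range (y + ℓ + 1),
    (-1 : ℝ) ^ x * (x : ℝ) ^ n * (Nat.choose (y + ℓ) x : ℝ) * (Nat.choose x y : ℝ)

lemma altBinomialSum_zero_right (n y : ℕ) : altBinomialSum n 0 y = (-1) ^ y * (y : ℝ) ^ n := by
  rw [altBinomialSum, add_zero, sum_range_succ, sum_eq_zero]
  · simp
  · intro x hx
    simp [Nat.choose_eq_zero_of_lt (mem_range.1 hx)]

lemma altBinomialSum_zero_left_succ (ℓ y : ℕ) : altBinomialSum 0 (ℓ + 1) y = 0 := by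
  have hsum : ∑ k ∈ range (ℓ + 2), (-1 : ℝ) ^ k * ((ℓ + 1).choose k : ℝ) = 0 := by
    have := Int.alternating_sum_range_choose (n := ℓ + 1)
    simp only [Nat.add_eq_zero_iff, one_ne_zero, and_false, if_false] at this
    exact_mod_cast this
  rw [altBinomialSum, show y + (ℓ + 1) + 1 = y + (ℓ + 2) by ring, sum_range_add,
    sum_eq_zero (s := range y), zero_add]
  · calc
      _ = ∑ k ∈ range (ℓ + 2), (-1 : ℝ) ^ y * ((y + (ℓ + 1)).choose y : ℝ) *
            ((-1 : ℝ) ^ k * ((ℓ + 1).choose k : ℝ)) := by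
        refine sum_congr rfl fun k hk => ?_
        have hk' := mem_range.1 hk
        have := Nat.choose_mul (n := y + (ℓ + 1)) (k := y + k) (s := y) (by omega)
        rw [Nat.add_sub_cancel_left, Nat.add_sub_cancel_left] at this
        have : ((y + (ℓ + 1)).choose (y + k) : ℝ) * ((y + k).choose y : ℝ) =
            ((y + (ℓ + 1)).choose y : ℝ) * ((ℓ + 1).choose k : ℝ) := by exact_mod_cast this
        rw [pow_zero, mul_one, mul_assoc, this]
        ring
      _ = 0 := by rw [← mul_sum, hsum, mul_zero]
  · intro x hx
    simp [Nat.choose_eq_zero_of_lt (mem_range.1 hx)]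

lemma cast_mul_choose_succ (N x : ℕ) :
    (x : ℝ) * ((N + 1).choose x : ℝ) = (N + 1) * ((N + 1).choose x - N.choose x) := by
  cases x with
  | zero => simp
  | succ k =>
    have h := Nat.add_one_mul_choose_eq N k
    have h' : ((N : ℝ) + 1) * N.choose k = (N + 1).choose (k + 1) * (k + 1) := by exact_mod_cast h
    have hp : ((N + 1).choose (k + 1) : ℝ) = N.choose k + N.choose (k + 1) := by
      exact_mod_cast Nat.choose_succ_succ' N k
    push_cast
    linear_combination -h' - (N + 1 : ℝ) * hp

lemma altBinomialSum_succ_succ (n ℓ y : ℕ) :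
    altBinomialSum (n + 1) (ℓ + 1) y =
      (y + ℓ + 1) * (altBinomialSum n (ℓ + 1) y - altBinomialSum n ℓ y) := by
  have hext : altBinomialSum n ℓ y = ∑ x ∈ range (y + (ℓ + 1) + 1),
      (-1 : ℝ) ^ x * (x : ℝ) ^ n * (Nat.choose (y + ℓ) x : ℝ) * (Nat.choose x y : ℝ) := by
    rw [sum_range_succ, Nat.choose_eq_zero_of_lt (show y + ℓ < y + (ℓ + 1) by omega)]
    simp [altBinomialSum, add_assoc]
  rw [hext, altBinomialSum, altBinomialSum, ← sum_sub_distrib, mul_sum]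
  refine sum_congr rfl fun x _ => ?_
  have h := cast_mul_choose_succ (y + ℓ) x
  push_cast at h
  rw [← add_assoc y ℓ 1]
  linear_combination (-1 : ℝ) ^ x * (x : ℝ) ^ n * (x.choose y : ℝ) * h

lemma altBinomialSum_eq_zero_of_lt {n ℓ : ℕ} (y : ℕ) (h : n < ℓ) : altBinomialSum n ℓ y = 0 := by
  induction n generalizing ℓ with
  | zero =>
    obtain ⟨ℓ, rfl⟩ := Nat.exists_eq_succ_of_ne_zero h.ne'
    exact altBinomialSum_zero_left_succ ℓ y
  | succ n ih =>
    obtain ⟨ℓ, rfl⟩ := Nat.exists_eq_succ_of_ne_zero (Nat.ne_zero_of_lt h)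
    rw [Nat.succ_eq_add_one, altBinomialSum_succ_succ, ih (by omega), ih (by omega), sub_zero,
      mul_zero]

/-- Signed binomial sums at consecutive values of `ℓ` are linked by a geometric convolution. -/
lemma altBinomialSum_add_succ (m ℓ y : ℕ) :
    altBinomialSum (m + (ℓ + 1)) (ℓ + 1) y =
      -∑ k ∈ range (m + 1), altBinomialSum (k + ℓ) ℓ y * (y + ℓ + 1) ^ (m - k + 1) := by
  induction m with
  | zero =>
    rw [zero_add, altBinomialSum_succ_succ, altBinomialSum_eq_zero_of_lt y (Nat.lt_succ_self ℓ)]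
    simp
    ring
  | succ m ih =>
    rw [show m + 1 + (ℓ + 1) = m + (ℓ + 1) + 1 by ring, altBinomialSum_succ_succ, ih,
      sum_range_succ _ (m + 1), show m + (ℓ + 1) = m + 1 + ℓ by ring]
    have : ∀ k ∈ range (m + 1),
        altBinomialSum (k + ℓ) ℓ y * (y + ℓ + 1 : ℝ) ^ (m + 1 - k + 1) =
          (y + ℓ + 1) * (altBinomialSum (k + ℓ) ℓ y * (y + ℓ + 1 : ℝ) ^ (m - k + 1)) := by
      intro k hk
      rw [Nat.sub_add_comm (Nat.le_of_lt_succ (mem_range.1 hk)), pow_succ _ (m - k + 1)]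
      ring
    rw [sum_congr rfl this, ← mul_sum]
    simp
    ring

/-- The tuple `f` extended by `1` in front and by the constant `m` behind. -/
def extTuple {ℓ : ℕ} (m : ℕ) (f : Fin ℓ → ℕ) (j : ℕ) : ℕ :=
  if j = 0 then 1 else if h : j - 1 < ℓ then f ⟨j - 1, h⟩ else m

/-- The product `y^{f₁} (y+1)^{f₂-f₁+1} ⋯ (y+ℓ)^{m-f_ℓ+1}`. -/
noncomputable def tupleWeight {ℓ : ℕ} (y m : ℕ) (f : Fin ℓ → ℕ) : ℝ :=
  ∏ j ∈ range (ℓ + 1),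
    ((y : ℝ) + (j : ℝ)) ^ (((extTuple m f (j + 1) : ℤ) - (extTuple m f j : ℤ) + 1).toNat)

/-- The weakly increasing `ℓ`-tuples of natural numbers bounded by `m`. -/
def monotoneTuples (ℓ m : ℕ) : Finset (Fin ℓ → ℕ) :=
  (Fintype.piFinset fun _ => range (m + 1)).filter Monotone

lemma mem_monotoneTuples {ℓ m : ℕ} {f : Fin ℓ → ℕ} :
    f ∈ monotoneTuples ℓ m ↔ (∀ j, f j ≤ m) ∧ Monotone f := by
  simp [monotoneTuples]

lemma snoc_mem_monotoneTuples {ℓ m k : ℕ} {f : Fin ℓ → ℕ} (hk : k ≤ m)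
    (hf : f ∈ monotoneTuples ℓ k) :
    (Fin.snoc f k : Fin (ℓ + 1) → ℕ) ∈ monotoneTuples (ℓ + 1) m := by
  rw [mem_monotoneTuples] at hf ⊢
  refine ⟨fun j => ?_, fun a b hab => ?_⟩
  · induction j using Fin.lastCases with
    | last => simpa using hk
    | cast j => simpa using (hf.1 j).trans hk
  · induction b using Fin.lastCases with
    | last =>
      induction a using Fin.lastCases with
      | last => exact le_rfl
      | cast a => simpa using hf.1 a
    | cast b =>
      induction a using Fin.lastCases with
      | last => exact absurd (lt_of_lt_of_le (Fin.castSucc_lt_last b) hab) (lt_irrefl _)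
      | cast a => simpa using hf.2 (Fin.castSucc_le_castSucc_iff.1 hab)

lemma init_mem_monotoneTuples {ℓ m : ℕ} {g : Fin (ℓ + 1) → ℕ}
    (hg : g ∈ monotoneTuples (ℓ + 1) m) :
    (Fin.init g : Fin ℓ → ℕ) ∈ monotoneTuples ℓ (g (Fin.last ℓ)) := by
  rw [mem_monotoneTuples] at hg ⊢
  exact ⟨fun j => hg.2 (Fin.le_last _), fun a b hab => hg.2 (Fin.castSucc_le_castSucc_iff.2 hab)⟩

lemma sum_monotoneTuples_succ {M : Type*} [AddCommMonoid M] (ℓ m : ℕ)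
    (F : (Fin (ℓ + 1) → ℕ) → M) :
    ∑ g ∈ monotoneTuples (ℓ + 1) m, F g =
      ∑ k ∈ range (m + 1), ∑ f ∈ monotoneTuples ℓ k, F (Fin.snoc f k) := by
  rw [sum_sigma']
  refine sum_bij' (fun g _ => ⟨g (Fin.last ℓ), Fin.init g⟩) (fun p _ => Fin.snoc p.2 p.1)
    (fun g hg => ?_) (fun p hp => ?_) (fun g _ => ?_) (fun p _ => ?_) (fun g _ => ?_)
  · exact mem_sigma.2 ⟨mem_range.2 (Nat.lt_succ_of_le ((mem_monotoneTuples.1 hg).1 _)),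
      init_mem_monotoneTuples hg⟩
  · obtain ⟨h₁, h₂⟩ := mem_sigma.1 hp
    exact snoc_mem_monotoneTuples (Nat.le_of_lt_succ (mem_range.1 h₁)) h₂
  · exact Fin.snoc_init_self g
  · simp
  · rw [Fin.snoc_init_self]

lemma extTuple_snoc {ℓ : ℕ} (m k : ℕ) (f : Fin ℓ → ℕ) {j : ℕ} (hj : j ≤ ℓ + 1) :
    extTuple m (Fin.snoc f k : Fin (ℓ + 1) → ℕ) j = extTuple k f j := by
  rcases j with _ | j
  · rfl
  · have h : j < ℓ + 1 := by omega
    by_cases h' : j < ℓ <;> simp [extTuple, Fin.snoc, h, h']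

lemma tupleWeight_snoc {ℓ : ℕ} (y : ℕ) {m k : ℕ} (hk : k ≤ m) (f : Fin ℓ → ℕ) :
    tupleWeight y m (Fin.snoc f k : Fin (ℓ + 1) → ℕ) =
      tupleWeight y k f * (y + ℓ + 1) ^ (m - k + 1) := by
  rw [tupleWeight, prod_range_succ, tupleWeight]
  congr 1
  · refine prod_congr rfl fun j hj => ?_
    have hj' := mem_range.1 hj
    rw [extTuple_snoc m k f (by omega), extTuple_snoc m k f (by omega)]
  · rw [extTuple_snoc m k f le_rfl]
    have h₁ : extTuple k f (ℓ + 1) = k := by simp [extTuple]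
    have h₂ : extTuple m (Fin.snoc f k : Fin (ℓ + 1) → ℕ) (ℓ + 1 + 1) = m := by simp [extTuple]
    rw [h₁, h₂]
    push_cast
    rw [← add_assoc]
    congr 1
    omega

lemma altBinomialSum_eq_sum_tupleWeight (m ℓ y : ℕ) :
    altBinomialSum (m + ℓ) ℓ y =
      (-1) ^ (y + ℓ) * ∑ f ∈ monotoneTuples ℓ m, tupleWeight y m f := by
  induction ℓ generalizing m with
  | zero =>
    have h : monotoneTuples 0 m = univ := by
      ext f
      simp [mem_monotoneTuples, Subsingleton.monotone, eq_iff_true_of_subsingleton]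
    simp [altBinomialSum_zero_right, h, tupleWeight, extTuple]
  | succ ℓ ih =>
    rw [altBinomialSum_add_succ, sum_monotoneTuples_succ, mul_sum, ← sum_neg_distrib]
    refine sum_congr rfl fun k hk => ?_
    rw [sum_congr rfl fun f _ => tupleWeight_snoc y (Nat.le_of_lt_succ (mem_range.1 hk)) f,
      ← sum_mul, ih]
    ring

lemma sum_monotone_fin {M : Type*} [AddCommMonoid M] (ℓ m : ℕ) (F : (Fin ℓ → ℕ) → M) :
    ∑ i ∈ univ.filter (fun i : Fin ℓ → Fin (m + 1) => Monotone i), F (fun j => i j) =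
      ∑ f ∈ monotoneTuples ℓ m, F f := by
  refine sum_bij (fun i _ j => (i j : ℕ)) (fun i hi => ?_) (fun i _ i' _ h => ?_)
    (fun f hf => ?_) (fun _ _ => rfl)
  · exact mem_monotoneTuples.2
      ⟨fun j => Nat.le_of_lt_succ (i j).isLt, fun a b hab => (mem_filter.1 hi).2 hab⟩
  · funext j
    exact Fin.ext (congrFun h j)
  · obtain ⟨h₁, h₂⟩ := mem_monotoneTuples.1 hf
    exact ⟨fun j => ⟨f j, Nat.lt_succ_of_le (h₁ j)⟩,
      mem_filter.2 ⟨mem_univ _, fun a b hab => h₂ hab⟩, rfl⟩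

/-- For `ℓ ≤ n` and any `y`,
`Σ_{x=0}^{y+ℓ} (-1)^x x^n C(y+ℓ, x) C(x, y)
  = (-1)^{y+ℓ} Σ_{0 ≤ i₁ ≤ ⋯ ≤ i_ℓ ≤ n-ℓ} y^{i₁} (y+1)^{i₂-i₁+1} ⋯ (y+ℓ)^{n-ℓ-i_ℓ+1}`,
the right-hand sum running over weakly increasing `ℓ`-tuples; the exponent of the factor
`(y+j)` is `i'_{j+1} - i'_j + 1` with conventions `i'_0 = 1` and `i'_{ℓ+1} = n - ℓ`
(for `ℓ = 0` the right-hand side is `(-1)^y y^n`). -/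
theorem alternating_binomial_power_sum (n ℓ y : ℕ) (h : ℓ ≤ n) :
    ∑ x ∈ Finset.range (y + ℓ + 1),
      (-1 : ℝ) ^ x * (x : ℝ) ^ n * (Nat.choose (y + ℓ) x : ℝ) * (Nat.choose x y : ℝ)
  = (-1 : ℝ) ^ (y + ℓ) *
      ∑ i ∈ Finset.univ.filter (fun i : Fin ℓ → Fin (n - ℓ + 1) => Monotone i),
        ∏ j ∈ Finset.range (ℓ + 1),
          ((y : ℝ) + (j : ℝ)) ^
            (((extIdx n ℓ i (j + 1) : ℤ) - (extIdx n ℓ i j : ℤ) + 1).toNat) := by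
  have hsum := altBinomialSum_eq_sum_tupleWeight (n - ℓ) ℓ y
  rw [Nat.sub_add_cancel h, ← sum_monotone_fin] at hsum
  exact hsum
end

section
/- Let m, n : ℕ and let a, b : ℤ → ℕ → ℝ be families of coefficient functions with a j = 0 whenever |j| > m and b k = 0 whenever |k| > n. Suppose that for all x, y : ℕ, Σ_{j=−m}^{m} a j x · C(x+j, y) = Σ_{k=−n}^{n} b k y · C(x, y+k), where C(u,v) denotes the binomial coefficient for integer arguments, equal to 0 if u < 0, v < 0, or v > u. Then the coefficients are recovered by the inversion formulas: (i) for every ℓ : ℤ and y : ℕ with y + ℓ ≥ 0, b ℓ y = (−1)^{y+ℓ} · Σ_{j=−m}^{m} Σ_{x=0}^{y+ℓ} (−1)^x · a j x · C(y+ℓ, x) · C(x+j, y); (ii) for every ℓ : ℤ and x : ℕ with x + ℓ ≥ 0, a ℓ x = (−1)^{x+ℓ} · Σ_{k=−n}^{n} Σ_{y=0}^{x+n} (−1)^y · b k y · C(y, x+ℓ) · C(x, y+k). -/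
/-- The binomial coefficient `C(u, v)` for integer arguments, equal to `Nat.choose u v`
when `0 ≤ v ≤ u` and `0` otherwise (in particular `0` when `u < 0`, `v < 0`, or `v > u`). -/
noncomputable def zchoose (u v : ℤ) : ℝ :=
  if 0 ≤ v ∧ v ≤ u then (Nat.choose u.toNat v.toNat : ℝ) else 0

theorem zchoose_natCast (u v : ℕ) : zchoose u v = (u.choose v : ℝ) := by
  unfold zchoose
  split_ifs with h
  · simp
  · rw [Nat.choose_eq_zero_of_lt (by omega), Nat.cast_zero]

theorem zchoose_eq_zero_of_not {u v : ℤ} (h : ¬(0 ≤ v ∧ v ≤ u)) : zchoose u v = 0 :=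
  if_neg h

/-- Orthogonality of the rows and columns of the Pascal matrix. -/
theorem sum_range_neg_one_pow_mul_choose_mul_choose {N K : ℕ} (M : ℕ) (hK : N < K) :
    ∑ x ∈ Finset.range K, (-1 : ℝ) ^ x * (N.choose x : ℝ) * (x.choose M : ℝ)
      = if N = M then (-1 : ℝ) ^ M else 0 := by
  rw [← Finset.sum_subset (Finset.range_mono (Nat.succ_le_of_lt hK)) fun x _ hx => by
    rw [Nat.choose_eq_zero_of_lt (by simpa using hx)]; simp]
  rcases lt_or_ge N M with hlt | hle
  · rw [if_neg hlt.ne]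
    refine Finset.sum_eq_zero fun x hx => ?_
    rw [Finset.mem_range] at hx
    rw [Nat.choose_eq_zero_of_lt (show x < M by omega)]
    simp
  · obtain ⟨d, rfl⟩ := Nat.exists_eq_add_of_le hle
    have hterm : ∀ i, (-1 : ℝ) ^ (M + i) * ((M + d).choose (M + i) : ℝ) * ((M + i).choose M : ℝ)
        = (-1 : ℝ) ^ M * ((M + d).choose M : ℝ) * (((-1) ^ i * (d.choose i : ℤ) : ℤ) : ℝ) := by
      intro i
      have h := Nat.choose_mul (n := M + d) (k := M + i) (s := M) (by omega)
      rw [Nat.add_sub_cancel_left, Nat.add_sub_cancel_left] at h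
      have h' : ((M + d).choose (M + i) : ℝ) * ((M + i).choose M : ℝ)
          = ((M + d).choose M : ℝ) * (d.choose i : ℝ) := by exact_mod_cast h
      push_cast
      rw [mul_assoc, h', pow_add]
      ring
    rw [Nat.succ_eq_add_one, add_assoc, Finset.sum_range_add, Finset.sum_eq_zero, zero_add,
      Finset.sum_congr rfl fun i _ => hterm i, ← Finset.mul_sum, ← Int.cast_sum,
      Int.alternating_sum_range_choose]
    · by_cases hd : d = 0 <;> simp [hd]
    · intro x hx
      rw [Nat.choose_eq_zero_of_lt (Finset.mem_range.mp hx)]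
      simp

theorem sum_range_neg_one_pow_mul_zchoose_mul_zchoose {u v : ℤ} {K : ℕ} (huv : 0 ≤ u ∨ 0 ≤ v)
    (hK : u < K) :
    ∑ x ∈ Finset.range K, (-1 : ℝ) ^ x * zchoose u x * zchoose x v
      = if u = v then (-1 : ℝ) ^ v else 0 := by
  by_cases hpos : 0 ≤ u ∧ 0 ≤ v
  · obtain ⟨hu, hv⟩ := hpos
    lift u to ℕ using hu
    lift v to ℕ using hv
    simp only [zchoose_natCast, Nat.cast_inj, zpow_natCast]
    exact sum_range_neg_one_pow_mul_choose_mul_choose v (by exact_mod_cast hK)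
  · rw [if_neg (by omega)]
    refine Finset.sum_eq_zero fun x _ => ?_
    rcases lt_or_ge u 0 with hu | hu
    · rw [zchoose_eq_zero_of_not (u := u) (by omega)]
      simp
    · rw [zchoose_eq_zero_of_not (v := v) (by omega)]
      simp

theorem neg_one_zpow_mul_sum_Icc_ite (m : ℕ) (c : ℤ → ℝ) (hc : ∀ j : ℤ, (m : ℤ) < |j| → c j = 0)
    (ℓ r : ℤ) :
    (-1 : ℝ) ^ r * ∑ j ∈ Finset.Icc (-(m : ℤ)) (m : ℤ), c j * (if j = ℓ then (-1 : ℝ) ^ r else 0)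
      = c ℓ := by
  have hsq : (-1 : ℝ) ^ r * (-1 : ℝ) ^ r = 1 := by
    rw [← mul_zpow]
    simp
  simp only [mul_ite, mul_zero, Finset.sum_ite_eq']
  split_ifs with hℓ
  · rw [mul_left_comm, hsq, mul_one]
  · rw [hc ℓ]
    rw [Finset.mem_Icc, ← abs_le] at hℓ
    exact not_le.mp hℓ

/-- Inversion formulas for the coefficients of dual difference operators acting on the
binomial function `ψ(x, y) = C(x, y)`: if
`Σ_{j=-m}^{m} a_j(x) C(x+j, y) = Σ_{k=-n}^{n} b_k(y) C(x, y+k)` for all `x, y ∈ ℕ`, then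
each `b_ℓ(y)` and each `a_ℓ(x)` is recovered as an alternating double sum. -/
theorem fourier_coefficient_inversion (m n : ℕ) (a b : ℤ → ℕ → ℝ)
    (ha : ∀ j : ℤ, (m : ℤ) < |j| → a j = 0)
    (hb : ∀ k : ℤ, (n : ℤ) < |k| → b k = 0)
    (h : ∀ x y : ℕ,
      ∑ j ∈ Finset.Icc (-(m : ℤ)) (m : ℤ), a j x * zchoose ((x : ℤ) + j) (y : ℤ)
        = ∑ k ∈ Finset.Icc (-(n : ℤ)) (n : ℤ), b k y * zchoose (x : ℤ) ((y : ℤ) + k)) :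
    (∀ (ℓ : ℤ) (y : ℕ), 0 ≤ (y : ℤ) + ℓ →
      b ℓ y = (-1 : ℝ) ^ ((y : ℤ) + ℓ) *
        ∑ j ∈ Finset.Icc (-(m : ℤ)) (m : ℤ),
          ∑ x ∈ Finset.range (((y : ℤ) + ℓ).toNat + 1),
            (-1 : ℝ) ^ x * a j x * zchoose ((y : ℤ) + ℓ) (x : ℤ)
              * zchoose ((x : ℤ) + j) (y : ℤ)) ∧
    (∀ (ℓ : ℤ) (x : ℕ), 0 ≤ (x : ℤ) + ℓ →
      a ℓ x = (-1 : ℝ) ^ ((x : ℤ) + ℓ) *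
        ∑ k ∈ Finset.Icc (-(n : ℤ)) (n : ℤ),
          ∑ y ∈ Finset.range (x + n + 1),
            (-1 : ℝ) ^ y * b k y * zchoose (y : ℤ) ((x : ℤ) + ℓ)
              * zchoose (x : ℤ) ((y : ℤ) + k)) := by
  refine ⟨fun ℓ y hℓ => ?_, fun ℓ x hℓ => ?_⟩
  · rw [← neg_one_zpow_mul_sum_Icc_ite n (fun k => b k y)
      (fun k hk => congrFun (hb k hk) y) ℓ (y + ℓ)]
    congr 1
    have hinner : ∀ k : ℤ, (if k = ℓ then (-1 : ℝ) ^ ((y : ℤ) + ℓ) else 0)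
        = ∑ x ∈ Finset.range (((y : ℤ) + ℓ).toNat + 1),
          (-1 : ℝ) ^ x * zchoose ((y : ℤ) + ℓ) x * zchoose x ((y : ℤ) + k) := by
      intro k
      rw [sum_range_neg_one_pow_mul_zchoose_mul_zchoose (Or.inl hℓ) (by omega)]
      by_cases hk : k = ℓ
      · simp [hk]
      · rw [if_neg hk, if_neg (by omega)]
    simp only [hinner, Finset.mul_sum]
    rw [Finset.sum_comm, Finset.sum_comm (s := Finset.Icc (-(m : ℤ)) (m : ℤ))]
    refine Finset.sum_congr rfl fun x _ => ?_
    have hx := congrArg (fun t => (-1 : ℝ) ^ x * zchoose ((y : ℤ) + ℓ) x * t) (h x y)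
    simp only [Finset.mul_sum] at hx
    refine (Finset.sum_congr rfl fun k _ => ?_).trans
      (hx.symm.trans (Finset.sum_congr rfl fun j _ => ?_)) <;> ring
  · rw [← neg_one_zpow_mul_sum_Icc_ite m (fun j => a j x)
      (fun j hj => congrFun (ha j hj) x) ℓ (x + ℓ)]
    congr 1
    have hinner : ∀ j ∈ Finset.Icc (-(m : ℤ)) (m : ℤ),
        a j x * (if j = ℓ then (-1 : ℝ) ^ ((x : ℤ) + ℓ) else 0)
        = ∑ y ∈ Finset.range (x + n + 1 + m),
          a j x * ((-1 : ℝ) ^ y * zchoose ((x : ℤ) + j) y * zchoose y ((x : ℤ) + ℓ)) := by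
      intro j hj
      rw [Finset.mem_Icc] at hj
      rw [← Finset.mul_sum,
        sum_range_neg_one_pow_mul_zchoose_mul_zchoose (Or.inr hℓ) (by push_cast; omega)]
      by_cases hjℓ : j = ℓ
      · simp [hjℓ]
      · rw [if_neg hjℓ, if_neg (by omega)]
    -- The terms with `y > x + n` vanish, so the range may be enlarged to cover every `x + j`.
    have hextend : ∀ k ∈ Finset.Icc (-(n : ℤ)) (n : ℤ),
        ∑ y ∈ Finset.range (x + n + 1),
          (-1 : ℝ) ^ y * b k y * zchoose (y : ℤ) ((x : ℤ) + ℓ) * zchoose (x : ℤ) ((y : ℤ) + k)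
        = ∑ y ∈ Finset.range (x + n + 1 + m),
          (-1 : ℝ) ^ y * b k y * zchoose (y : ℤ) ((x : ℤ) + ℓ)
            * zchoose (x : ℤ) ((y : ℤ) + k) := by
      intro k hk
      rw [Finset.mem_Icc] at hk
      refine Finset.sum_subset (Finset.range_mono (Nat.le_add_right _ _)) fun y _ hy => ?_
      rw [Finset.mem_range] at hy
      rw [zchoose_eq_zero_of_not (u := (x : ℤ)) (by omega), mul_zero]
    rw [Finset.sum_congr rfl hinner, Finset.sum_congr rfl hextend, Finset.sum_comm,
      Finset.sum_comm (s := Finset.Icc (-(n : ℤ)) (n : ℤ))]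
    refine Finset.sum_congr rfl fun y _ => ?_
    have hy := congrArg (fun t => (-1 : ℝ) ^ y * zchoose y ((x : ℤ) + ℓ) * t) (h x y)
    simp only [Finset.mul_sum] at hy
    refine (Finset.sum_congr rfl fun j _ => ?_).trans
      (hy.trans (Finset.sum_congr rfl fun k _ => ?_)) <;> ring
end

section
/- Let N be an odd natural number with N ≥ 3, and define v : Fin N → ℝ recursively by v 0 = 1, v 1 = 1/2, and for 1 ≤ k ≤ N−2, v (k+1) = ( ((N²−1)/2)·v k + k·(N² − 2k² − 3k − 2)·v k − k·(N² − k²)·v (k−1) ) / ( (k+1)·(N² − (k+1)²) ). Then J_N.mulVec v = ((N² − 1)/2 : ℝ) • v; i.e. v is an eigenvector of J_N with eigenvalue (N²−1)/2 (equivalently, an eigenvector of the Pascal matrix T_N with eigenvalue 1). -/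
open Matrix

/-- Off-diagonal coefficients of the Jacobi operator with parameter `x`. -/
noncomputable def jacobiOff (x : ℝ) (n : ℕ) : ℝ := n * (x - (n : ℝ) ^ 2)

/-- Diagonal coefficients of the Jacobi operator with parameter `x`. -/
noncomputable def jacobiDiag (x : ℝ) (n : ℕ) : ℝ :=
  -x * n + 2 * (n : ℝ) ^ 3 + 3 * (n : ℝ) ^ 2 + 2 * n

/-- The Jacobi operator with parameter `x` on sequences. -/
noncomputable def jacobiOp (x : ℝ) (V : ℕ → ℝ) (n : ℕ) : ℝ :=
  jacobiOff x n * V (n - 1) + jacobiDiag x n * V n + jacobiOff x (n + 1) * V (n + 1)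

/-- The signed binomial transform of a sequence. -/
noncomputable def binomTransform (V : ℕ → ℝ) (n : ℕ) : ℝ :=
  ∑ k ∈ Finset.range (n + 1), (-1) ^ k * (n.choose k : ℝ) * V k

lemma binomTransform_eq_sum_range (V : ℕ → ℝ) {n M : ℕ} (h : n + 1 ≤ M) :
    binomTransform V n = ∑ k ∈ Finset.range M, (-1) ^ k * (n.choose k : ℝ) * V k := by
  refine Finset.sum_subset (Finset.range_mono h) fun k _ hk => ?_
  rw [Nat.choose_eq_zero_of_lt (by simpa using hk)]
  simp

lemma sub_mul_choose_eq (n k : ℕ) :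
    ((n : ℝ) - k) * n.choose k = (k + 1) * n.choose (k + 1) := by
  rcases le_or_gt k n with h | h
  · have := Nat.choose_succ_right_eq n k
    rw [← Nat.cast_sub h]
    exact_mod_cast (by linarith : (n - k) * n.choose k = (k + 1) * n.choose (k + 1))
  · simp [Nat.choose_eq_zero_of_lt h, Nat.choose_eq_zero_of_lt (h.trans (Nat.lt_succ_self k))]

lemma mul_choose_pred_eq (n k : ℕ) :
    (n : ℝ) * (n - 1).choose k = (n - k) * n.choose k := by
  cases n with
  | zero => cases k <;> simp
  | succ n =>
    rw [sub_mul_choose_eq]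
    have := Nat.add_one_mul_choose_eq n k
    simp only [Nat.add_sub_cancel]
    exact_mod_cast (by linarith : (n + 1) * n.choose k = (k + 1) * (n + 1).choose (k + 1))

/-- The entrywise form of the anticommutation of the Jacobi operator (recentred) with the
signed binomial transform. -/
lemma jacobi_choose_identity (x : ℝ) (n k : ℕ) :
    jacobiOff x n * (n - 1).choose k + jacobiDiag x n * n.choose k
      + jacobiOff x (n + 1) * (n + 1).choose k + jacobiDiag x k * n.choose k
      - jacobiOff x (k + 1) * n.choose (k + 1) - jacobiOff x k * n.choose (k - 1)
      = (x - 1) * n.choose k := by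
  have e1 := mul_choose_pred_eq n k
  have e2 := sub_mul_choose_eq n k
  simp only [jacobiOff, jacobiDiag]
  cases k with
  | zero =>
    push_cast at *
    simp only [Nat.choose_zero_right, Nat.cast_one, zero_add] at *
    linear_combination (x - (n : ℝ) ^ 2) * e1 + (x - 1) * e2
  | succ k =>
    have e3 := sub_mul_choose_eq n k
    have e4 : ((n + 1).choose (k + 1) : ℝ) = n.choose k + n.choose (k + 1) := by
      exact_mod_cast Nat.choose_succ_succ n k
    rw [e4]
    push_cast at *
    linear_combination (x - (n : ℝ) ^ 2) * e1 + (x - ((k : ℝ) + 2) ^ 2) * e2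
      + (x - (((n : ℝ) + 1) ^ 2 + (n + 1) * (k + 1) + ((k : ℝ) + 1) ^ 2)) * e3

lemma binomTransform_jacobiOp (x : ℝ) (V : ℕ → ℝ) (n : ℕ) :
    binomTransform (jacobiOp x V) n + jacobiOp x (binomTransform V) n
      = (x - 1) * binomTransform V n := by
  have lower : ∑ k ∈ Finset.range (n + 2),
        (-1) ^ k * (n.choose k : ℝ) * (jacobiOff x k * V (k - 1))
      = ∑ k ∈ Finset.range (n + 2),
        (-1) ^ k * (-(jacobiOff x (k + 1) * n.choose (k + 1))) * V k := by
    rw [Finset.sum_range_succ', Finset.sum_range_succ _ (n + 1)]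
    simp only [jacobiOff, Nat.choose_eq_zero_of_lt (show n < n + 1 + 1 by omega)]
    simp only [Nat.cast_zero, zero_mul, mul_zero, add_zero, neg_zero, Nat.add_sub_cancel]
    exact Finset.sum_congr rfl fun k _ => by ring
  have upper : ∑ k ∈ Finset.range (n + 2),
        (-1) ^ k * (n.choose k : ℝ) * (jacobiOff x (k + 1) * V (k + 1))
      = ∑ k ∈ Finset.range (n + 2),
        (-1) ^ k * (-(jacobiOff x k * n.choose (k - 1))) * V k := by
    rw [Finset.sum_range_succ, Finset.sum_range_succ' _ (n + 1)]
    simp only [jacobiOff, Nat.choose_eq_zero_of_lt (Nat.lt_succ_self n)]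
    simp only [Nat.cast_zero, zero_mul, mul_zero, add_zero, neg_zero, Nat.add_sub_cancel]
    exact Finset.sum_congr rfl fun k _ => by ring
  have split : binomTransform (jacobiOp x V) n
      = ∑ k ∈ Finset.range (n + 2), (-1) ^ k * (n.choose k : ℝ) * (jacobiOff x k * V (k - 1))
        + ∑ k ∈ Finset.range (n + 2), (-1) ^ k * (n.choose k : ℝ) * (jacobiDiag x k * V k)
        + ∑ k ∈ Finset.range (n + 2),
          (-1) ^ k * (n.choose k : ℝ) * (jacobiOff x (k + 1) * V (k + 1)) := by
    rw [binomTransform_eq_sum_range _ (show n + 1 ≤ n + 2 by omega),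
      ← Finset.sum_add_distrib, ← Finset.sum_add_distrib]
    exact Finset.sum_congr rfl fun k _ => by simp only [jacobiOp]; ring
  rw [split, lower, upper]
  simp only [jacobiOp]
  rw [binomTransform_eq_sum_range V (show n - 1 + 1 ≤ n + 2 by omega),
    binomTransform_eq_sum_range V (show n + 1 ≤ n + 2 by omega),
    binomTransform_eq_sum_range V (show n + 1 + 1 ≤ n + 2 by omega)]
  simp only [Finset.mul_sum, ← Finset.sum_add_distrib]
  refine Finset.sum_congr rfl fun k _ => ?_
  linear_combination (-1) ^ k * V k * jacobi_choose_identity x n k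

lemma jacobiOff_sq_ne_zero {N n : ℕ} (hn : 0 < n) (h : n < N) :
    jacobiOff ((N : ℝ) ^ 2) n ≠ 0 := by
  have h1 : (0 : ℝ) < n := by exact_mod_cast hn
  have h2 : (n : ℝ) < N := by exact_mod_cast h
  exact (mul_pos h1 (by nlinarith)).ne'

/-- For odd `N`, a sequence satisfying the eigenvalue equations with eigenvalue `(N² - 1) / 2`
in all rows but the last satisfies it in the last row as well. -/
lemma jacobiOp_last_row {m : ℕ} (hm : Even m) (V : ℕ → ℝ)
    (hV : ∀ n < m, jacobiOp (((m + 1 : ℕ) : ℝ) ^ 2) V n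
      = ((((m + 1 : ℕ) : ℝ) ^ 2 - 1) / 2) * V n) :
    jacobiOp (((m + 1 : ℕ) : ℝ) ^ 2) V m = ((((m + 1 : ℕ) : ℝ) ^ 2 - 1) / 2) * V m := by
  set x : ℝ := ((m + 1 : ℕ) : ℝ) ^ 2 with hx
  set U := binomTransform V with hU
  have hUrow : ∀ n < m, jacobiOp x U n = ((x - 1) / 2) * U n := by
    intro n hn
    have e : binomTransform (jacobiOp x V) n = ((x - 1) / 2) * U n := by
      rw [hU, binomTransform, binomTransform, Finset.mul_sum]
      refine Finset.sum_congr rfl fun k hk => ?_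
      rw [hV k (by have := Finset.mem_range.1 hk; omega)]
      ring
    linear_combination binomTransform_jacobiOp x V n - e
  have hUV : ∀ n ≤ m, U n = V n := by
    intro n
    induction n using Nat.strong_induction_on with
    | _ n ih =>
      intro hn
      cases n with
      | zero => simp [hU, binomTransform]
      | succ n =>
        have h1 := hUrow n hn
        have h2 := hV n hn
        simp only [jacobiOp] at h1 h2
        rw [ih n (by omega) (by omega), ih (n - 1) (by omega) (by omega)] at h1
        refine mul_left_cancel₀ (jacobiOff_sq_ne_zero (N := m + 1) n.succ_pos (by omega)) ?_
        linear_combination h1 - h2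
  have hlast : jacobiOff x (m + 1) = 0 := by simp [jacobiOff, hx]
  have hsame : jacobiOp x U m = jacobiOp x V m := by
    simp only [jacobiOp, hlast, hUV m le_rfl, hUV (m - 1) (by omega), zero_mul]
  have e : binomTransform (jacobiOp x V) m - jacobiOp x V m
      = ((x - 1) / 2) * (U m - V m) := by
    rw [hU, binomTransform, binomTransform, Finset.sum_range_succ, Finset.sum_range_succ,
      hm.neg_one_pow, Nat.choose_self]
    have : ∑ k ∈ Finset.range m, (-1) ^ k * (m.choose k : ℝ) * jacobiOp x V k
        = ((x - 1) / 2) * ∑ k ∈ Finset.range m, (-1) ^ k * (m.choose k : ℝ) * V k := by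
      rw [Finset.mul_sum]
      refine Finset.sum_congr rfl fun k hk => ?_
      rw [hV k (Finset.mem_range.1 hk)]
      ring
    rw [this]
    push_cast
    ring
  have key := binomTransform_jacobiOp x V m
  rw [← hU, hsame, hUV m le_rfl] at key
  rw [hUV m le_rfl] at e
  linear_combination key / 2 - e / 2

lemma jacobiJ_mulVec_eq_jacobiOp {N : ℕ} (V : ℕ → ℝ) (j : Fin N) :
    (jacobiJ N).mulVec (fun i : Fin N => V i) j = jacobiOp ((N : ℝ) ^ 2) V j := by
  obtain ⟨j, hj⟩ := j
  have hentry : ∀ k : ℕ, (if j = k then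
        -((N : ℝ) ^ 2) * (j : ℝ) + 2 * (j : ℝ) ^ 3 + 3 * (j : ℝ) ^ 2 + 2 * (j : ℝ)
      else if j + 1 = k then (k : ℝ) * ((N : ℝ) ^ 2 - (k : ℝ) ^ 2)
      else if k + 1 = j then (j : ℝ) * ((N : ℝ) ^ 2 - (j : ℝ) ^ 2)
      else 0) * V k
      = (if k = j - 1 then jacobiOff ((N : ℝ) ^ 2) j * V (j - 1) else 0)
        + (if k = j then jacobiDiag ((N : ℝ) ^ 2) j * V j else 0)
        + (if k = j + 1 then jacobiOff ((N : ℝ) ^ 2) (j + 1) * V (j + 1) else 0) := by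
    intro k
    rcases Nat.eq_zero_or_pos j with rfl | hpos
    · rcases eq_or_ne k 0 with rfl | h0
      · simp [jacobiOff, jacobiDiag]
      · rcases eq_or_ne k 1 with rfl | h1
        · simp [jacobiOff]
        · simp [h0, h0.symm, h1, h1.symm]
    · rcases eq_or_ne k j with rfl | h0
      · simp [jacobiDiag, show k ≠ k - 1 by omega]
      · rcases eq_or_ne k (j + 1) with rfl | h1
        · simp [jacobiOff, show j + 1 ≠ j - 1 by omega]
        · rcases eq_or_ne k (j - 1) with rfl | h2
          · simp [jacobiOff, show j ≠ j - 1 by omega, show j - 1 ≠ j by omega,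
              show j + 1 ≠ j - 1 by omega, show j - 1 ≠ j + 1 by omega,
              show j - 1 + 1 = j by omega]
          · simp [h0, h0.symm, h1, h1.symm, h2, show k + 1 ≠ j by omega]
  simp only [Matrix.mulVec, dotProduct, jacobiJ, hentry]
  rw [Fin.sum_univ_eq_sum_range (fun k =>
    (if k = j - 1 then jacobiOff ((N : ℝ) ^ 2) j * V (j - 1) else 0)
      + (if k = j then jacobiDiag ((N : ℝ) ^ 2) j * V j else 0)
      + (if k = j + 1 then jacobiOff ((N : ℝ) ^ 2) (j + 1) * V (j + 1) else 0)) N]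
  rw [Finset.sum_add_distrib, Finset.sum_add_distrib, Finset.sum_ite_eq', Finset.sum_ite_eq',
    Finset.sum_ite_eq', if_pos (Finset.mem_range.2 (by omega)), if_pos (Finset.mem_range.2 hj)]
  simp only [jacobiOp]
  congr 1
  split_ifs with h
  · rfl
  · have : N = j + 1 := by simp at h; omega
    simp [this, jacobiOff]

/-- For odd `N ≥ 3`, the vector `v` defined recursively by `v 0 = 1`, `v 1 = 1/2`, and
`v (k+1) = ( ((N²-1)/2)·v k + k(N² - 2k² - 3k - 2)·v k - k(N² - k²)·v (k-1) )
            / ( (k+1)(N² - (k+1)²) )` for `1 ≤ k ≤ N-2`,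
is an eigenvector of `J_N` with eigenvalue `(N² - 1)/2` (equivalently, an eigenvector of
the Pascal matrix `T_N` with eigenvalue `1`). -/
theorem recursive_middle_eigenvector (N : ℕ) (hN : Odd N) (h3 : 3 ≤ N)
    (v : Fin N → ℝ)
    (h0 : v ⟨0, by omega⟩ = 1)
    (h1 : v ⟨1, by omega⟩ = 1 / 2)
    (hrec : ∀ (k : ℕ) (hk1 : 1 ≤ k) (hk2 : k ≤ N - 2),
      v ⟨k + 1, by omega⟩ =
        (((N : ℝ) ^ 2 - 1) / 2 * v ⟨k, by omega⟩
            + (k : ℝ) * ((N : ℝ) ^ 2 - 2 * (k : ℝ) ^ 2 - 3 * (k : ℝ) - 2) * v ⟨k, by omega⟩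
            - (k : ℝ) * ((N : ℝ) ^ 2 - (k : ℝ) ^ 2) * v ⟨k - 1, by omega⟩)
          / (((k : ℝ) + 1) * ((N : ℝ) ^ 2 - ((k : ℝ) + 1) ^ 2))) :
    (jacobiJ N).mulVec v = (((N : ℝ) ^ 2 - 1) / 2) • v := by
  obtain ⟨V, hVv⟩ : ∃ V : ℕ → ℝ, v = fun i : Fin N => V i :=
    ⟨fun n => if h : n < N then v ⟨n, h⟩ else 0, by ext i; simp⟩
  subst hVv
  simp only at h0 h1 hrec
  have hrow : ∀ n < N - 1,
      jacobiOp ((N : ℝ) ^ 2) V n = (((N : ℝ) ^ 2 - 1) / 2) * V n := by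
    intro n hn
    rcases Nat.eq_zero_or_pos n with rfl | hpos
    · simp only [jacobiOp, jacobiOff, jacobiDiag, zero_add, h0, h1]
      push_cast
      ring
    · have h := hrec n hpos (by omega)
      have hne := jacobiOff_sq_ne_zero (N := N) n.succ_pos (by omega)
      simp only [jacobiOff, Nat.succ_eq_add_one, Nat.cast_add, Nat.cast_one] at hne
      rw [eq_div_iff hne] at h
      simp only [jacobiOp, jacobiOff, jacobiDiag]
      push_cast
      linear_combination h
  obtain ⟨m, rfl⟩ : ∃ m, N = m + 1 := ⟨N - 1, by omega⟩
  have hm : Even m := by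
    rcases hN with ⟨t, ht⟩
    exact ⟨t, by omega⟩
  ext j
  rw [jacobiJ_mulVec_eq_jacobiOp]
  simp only [Pi.smul_apply, smul_eq_mul]
  rcases Nat.lt_or_ge j.1 m with h | h
  · exact hrow j (by omega)
  · rw [show j.1 = m by omega]
    exact jacobiOp_last_row hm V fun n hn => hrow n (by omega)
end
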